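/- Raising relation in the first degree index n₁: for every real q with 0 < q < 1, every integer N ≥ 1, all nonzero real numbers θ, φ, all integers n₁, n₂ ≥ 0 with n₁+n₂ ≤ N-1, and all integers x₁, x₂ ≥ 0 with x₁+x₂ ≤ N, one has q^{-n₁} K_{n₁+1,n₂}(x₁,x₂; q^{1/2}θ, φ; N) = q^{-(x₁+x₂)} (1-q^{x₁}) (1-θ^{-2}q^{x₂}) K_{n₁,n₂}(x₁-1,x₂; θ,φ; N-1) - (1-q^{-x₂}) K_{n₁,n₂}(x₁,x₂-1; θ,φ; N-1). -/

import Mathlib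

open Finset

/-- The q-Pochhammer symbol `(a;q)_n = ∏_{k=0}^{n-1} (1 - a q^k)`. -/
noncomputable def qPoch (q a : ℝ) (n : ℕ) : ℝ := ∏ k ∈ Finset.range n, (1 - a * q ^ k)

/-- The quantum q-Krawtchouk polynomial `k_n(x;p,N;q)`, defined for all integers `x, N`. -/
noncomputable def qKraw (q : ℝ) (n : ℕ) (x N : ℤ) (p : ℝ) : ℝ :=
  (-1 : ℝ) ^ n * q ^ (n * (n - 1) / 2) *
    ∑ k ∈ Finset.range (n + 1),
      qPoch q (q ^ (-(n : ℤ))) k * qPoch q (q ^ (-x)) k *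
        qPoch q (q ^ ((k : ℤ) - N)) (n - k) / qPoch q q k * (p * q ^ (n + 1)) ^ k

/-- The bivariate quantum q-Krawtchouk polynomial of Gasper and Rahman,
`K_{n₁,n₂}(x₁,x₂;θ,φ;N) = k_{n₁}(x₁;θ^{-2},x₁+x₂;q) k_{n₂}(x₁+x₂-n₁;φ^{-2},N-n₁;q)`,
with the convention that it vanishes when a degree index is negative. -/
noncomputable def Kq (q : ℝ) (n₁ n₂ x₁ x₂ : ℤ) (θ φ : ℝ) (N : ℤ) : ℝ :=
  if 0 ≤ n₁ ∧ 0 ≤ n₂ then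
    qKraw q n₁.toNat x₁ (x₁ + x₂) (θ ^ 2)⁻¹ *
      qKraw q n₂.toNat (x₁ + x₂ - n₁) (N - n₁) (φ ^ 2)⁻¹
  else 0

/-- The q-trinomial coefficient `[N; x₁, x₂]_q`. -/
noncomputable def qTrinom (q : ℝ) (N x₁ x₂ : ℕ) : ℝ :=
  qPoch q q N / (qPoch q q x₁ * qPoch q q x₂ * qPoch q q (N - x₁ - x₂))

/-- The orthogonality weight `Δ^{(N)}_{x₁,x₂}(θ,φ)`. -/
noncomputable def Δw (q : ℝ) (N x₁ x₂ : ℕ) (θ φ : ℝ) : ℝ :=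
  (-1 : ℝ) ^ (N - x₁) * (θ ^ 2 * q⁻¹) ^ (x₁ + x₂) * q ^ (x₁ * (x₁ - 1) / 2) *
    qTrinom q N x₁ x₂ * qPoch q ((θ ^ 2)⁻¹ * q) x₂ * qPoch q ((φ ^ 2)⁻¹ * q) (N - x₁ - x₂) *
    φ ^ (2 * N) * q ^ (-((N : ℤ) * (N + 1) / 2))

/-- The normalization constant `H^{(N)}_{n₁,n₂}(θ,φ)`. -/
noncomputable def Hn (q : ℝ) (N n₁ n₂ : ℕ) (θ φ : ℝ) : ℝ :=
  (-1 : ℝ) ^ (n₁ + n₂) * qPoch q (q * (θ ^ 2)⁻¹) n₁ * qPoch q (q * (φ ^ 2)⁻¹) n₂ *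
    φ ^ (2 * n₁) * (qPoch q q N / qPoch q q (N - n₁ - n₂)) ^ 2 * (qTrinom q N n₁ n₂)⁻¹ *
    q ^ (3 * ((n₁ : ℤ) * (n₁ - 1)) / 2 + 3 * ((n₂ : ℤ) * (n₂ - 1)) / 2 +
          (n₁ : ℤ) * n₂ - (N : ℤ) * (n₁ + n₂) - 2 * n₁ - n₂)

/-- The dual weight `Δ̃^{(N)}_{n₁,n₂}(θ,φ)`. -/
noncomputable def Δdual (q : ℝ) (N n₁ n₂ : ℕ) (θ φ : ℝ) : ℝ :=
  (-1 : ℝ) ^ (n₁ + n₂) * q ^ (-((n₁ : ℤ) * (n₁ - 1)) - (n₂ : ℤ) * (n₂ - 1)) *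
    φ ^ (-(2 * (n₁ : ℤ))) * (qPoch q q (N - n₁ - n₂) / qPoch q q N) ^ 2 * qTrinom q N n₁ n₂ *
    q ^ ((N : ℤ) * (n₁ + n₂) + 2 * n₁ + n₂ - (n₁ : ℤ) * n₂ -
          (n₁ : ℤ) * (n₁ - 1) / 2 - (n₂ : ℤ) * (n₂ - 1) / 2) /
    (qPoch q (q * (θ ^ 2)⁻¹) n₁ * qPoch q (q * (φ ^ 2)⁻¹) n₂)

lemma qPoch_zero (q a : ℝ) : qPoch q a 0 = 1 := by simp [qPoch]

lemma qPoch_succ (q a : ℝ) (n : ℕ) : qPoch q a (n + 1) = qPoch q a n * (1 - a * q ^ n) :=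
  Finset.prod_range_succ _ _

lemma qPoch_succ' (q a : ℝ) (n : ℕ) : qPoch q a (n + 1) = (1 - a) * qPoch q (a * q) n := by
  rw [qPoch, Finset.prod_range_succ', mul_comm, qPoch]
  simp [pow_succ', mul_assoc]

lemma qPoch_self_ne_zero {q : ℝ} (hq0 : 0 < q) (hq1 : q < 1) (n : ℕ) : qPoch q q n ≠ 0 := by
  refine Finset.prod_ne_zero_iff.mpr fun k _ => ?_
  rw [← pow_succ']
  exact (sub_pos.mpr (pow_lt_one₀ hq0.le hq1 k.succ_ne_zero)).ne'

/-- Contiguous relation for the terms `(q^{-n};q)_j q^{(n+1)j} / (q;q)_j`. -/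
lemma qPoch_neg_succ_div {q : ℝ} (hq0 : 0 < q) (hq1 : q < 1) (n j : ℕ) :
    qPoch q (q ^ (-((n + 1 : ℕ) : ℤ))) (j + 1) / qPoch q q (j + 1) * (q ^ (n + 1)) ^ (j + 1) =
      qPoch q (q ^ (-(n : ℤ))) (j + 1) / qPoch q q (j + 1) * (q ^ (n + 1)) ^ (j + 1) -
        qPoch q (q ^ (-(n : ℤ))) j / qPoch q q j * (q ^ (n + 1)) ^ j := by
  have hq := hq0.ne'
  have hc : q ^ (-((n + 1 : ℕ) : ℤ)) * q = q ^ (-(n : ℤ)) := by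
    rw [← zpow_add_one₀ hq]; congr 1; push_cast; ring
  have hd : q ^ (-((n + 1 : ℕ) : ℤ)) * q ^ (n + 1) = 1 := by
    rw [zpow_neg, zpow_natCast]; exact inv_mul_cancel₀ (pow_ne_zero _ hq)
  have h1 := qPoch_self_ne_zero hq0 hq1 (j + 1)
  have h0 := qPoch_self_ne_zero hq0 hq1 j
  rw [qPoch_succ' q (q ^ (-((n + 1 : ℕ) : ℤ))), hc, qPoch_succ q (q ^ (-(n : ℤ)))]
  rw [qPoch_succ] at h1 ⊢
  have h2 := right_ne_zero_of_mul h1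
  rw [← hc]
  generalize q ^ (-((n + 1 : ℕ) : ℤ)) = d at *
  generalize qPoch q (d * q) j = A
  rw [pow_succ (q ^ (n + 1)) j]
  generalize (q ^ (n + 1)) ^ j = B
  generalize q ^ (n + 1) = e at *
  field_simp
  linear_combination (-A * B * (1 - q * q ^ j)) * hd

/-- Raising relation for the univariate quantum `q`-Krawtchouk polynomials. -/
lemma qKraw_raising {q : ℝ} (hq0 : 0 < q) (hq1 : q < 1) (n : ℕ) (x y : ℤ) (p : ℝ) :
    q ^ (-(n : ℤ)) * qKraw q (n + 1) x (x + y) (q⁻¹ * p) =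
      q ^ (-(x + y)) * (1 - q ^ x) * (1 - p * q ^ y) * qKraw q n (x - 1) (x + y - 1) p -
        (1 - q ^ (-y)) * qKraw q n x (x + y - 1) p := by
  have hq := hq0.ne'
  set F : ℕ → ℝ := fun j => qPoch q (q ^ (-(n : ℤ))) j / qPoch q q j * (q ^ (n + 1)) ^ j *
    (qPoch q (q ^ (-x)) j * qPoch q (q ^ ((j : ℤ) - (x + y))) (n + 1 - j) * p ^ j) with hF
  set G : ℕ → ℝ := fun j => qPoch q (q ^ (-(n : ℤ))) j / qPoch q q j * (q ^ (n + 1)) ^ j *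
    (qPoch q (q ^ (-x)) (j + 1) * qPoch q (q ^ (((j + 1 : ℕ) : ℤ) - (x + y))) (n - j) *
      p ^ (j + 1)) with hG
  have hlast : F (n + 1) = 0 := by
    have : qPoch q (q ^ (-(n : ℤ))) (n + 1) = 0 := by
      rw [qPoch_succ, zpow_neg, zpow_natCast, inv_mul_cancel₀ (pow_ne_zero _ hq)]
      ring
    simp only [hF, this, zero_div, zero_mul]
  have hp : q⁻¹ * p * q ^ (n + 1 + 1) = q ^ (n + 1) * p := by
    rw [pow_succ q (n + 1)]; field_simp
  have hpow : q ^ (-(n : ℤ)) * q ^ ((n + 1) * (n + 1 - 1) / 2) = q ^ (n * (n - 1) / 2) := by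
    have : (n + 1) * (n + 1 - 1) / 2 = n * (n - 1) / 2 + n := by
      rw [← Finset.sum_range_id, ← Finset.sum_range_id, Finset.sum_range_succ]
    rw [this, pow_add, zpow_neg, zpow_natCast]
    field_simp
  have hL : q ^ (-(n : ℤ)) * qKraw q (n + 1) x (x + y) (q⁻¹ * p) =
      (-1) ^ n * q ^ (n * (n - 1) / 2) * ∑ j ∈ Finset.range (n + 1), (G j - F j) := by
    have hS : ∑ k ∈ Finset.range (n + 1 + 1),
        qPoch q (q ^ (-((n + 1 : ℕ) : ℤ))) k * qPoch q (q ^ (-x)) k *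
          qPoch q (q ^ ((k : ℤ) - (x + y))) (n + 1 - k) / qPoch q q k *
            (q⁻¹ * p * q ^ (n + 1 + 1)) ^ k =
        -∑ j ∈ Finset.range (n + 1), (G j - F j) := by
      rw [hp, Finset.sum_range_succ', Finset.sum_sub_distrib]
      have h := Finset.sum_range_succ' F (n + 1)
      rw [Finset.sum_range_succ, hlast, add_zero] at h
      rw [h, neg_sub, add_sub_right_comm, ← Finset.sum_sub_distrib]
      congr 1
      · refine Finset.sum_congr rfl fun j _ => ?_
        simp only [hF, hG, Nat.add_sub_add_right]
        rw [mul_pow]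
        linear_combination (qPoch q (q ^ (-x)) (j + 1) *
          qPoch q (q ^ (((j + 1 : ℕ) : ℤ) - (x + y))) (n - j) * p ^ (j + 1)) *
            qPoch_neg_succ_div hq0 hq1 n j
      · simp [hF, qPoch_zero]
    rw [qKraw, hS, ← hpow]
    ring
  rw [hL, qKraw, qKraw]
  have hR : ∀ j ∈ Finset.range (n + 1), G j - F j =
      q ^ (-(x + y)) * (1 - q ^ x) * (1 - p * q ^ y) *
        (qPoch q (q ^ (-(n : ℤ))) j * qPoch q (q ^ (-(x - 1))) j *
          qPoch q (q ^ ((j : ℤ) - (x + y - 1))) (n - j) / qPoch q q j * (p * q ^ (n + 1)) ^ j) -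
      (1 - q ^ (-y)) *
        (qPoch q (q ^ (-(n : ℤ))) j * qPoch q (q ^ (-x)) j *
          qPoch q (q ^ ((j : ℤ) - (x + y - 1))) (n - j) / qPoch q q j *
            (p * q ^ (n + 1)) ^ j) := by
    intro j hj
    have hjn : n + 1 - j = n - j + 1 := by have := Finset.mem_range.mp hj; omega
    have e1 : q ^ (((j + 1 : ℕ) : ℤ) - (x + y)) = q ^ ((j : ℤ) - (x + y - 1)) := by
      congr 1; push_cast; ring
    have e2 : q ^ ((j : ℤ) - (x + y)) * q = q ^ ((j : ℤ) - (x + y - 1)) := by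
      rw [← zpow_add_one₀ hq]; congr 1; ring
    have e3 : q ^ (-(x - 1)) = q ^ (-x) * q := by
      rw [← zpow_add_one₀ hq]; congr 1; ring
    have e4 : q ^ ((j : ℤ) - (x + y)) = q ^ j * (q ^ (-x) * q ^ (-y)) := by
      rw [← zpow_add₀ hq, ← zpow_natCast, ← zpow_add₀ hq]; congr 1; ring
    have e5 : q ^ (-(x + y)) = q ^ (-x) * q ^ (-y) := by
      rw [← zpow_add₀ hq]; congr 1; ring
    have hx : q ^ (-x) * q ^ x = 1 := by rw [← zpow_add₀ hq]; simp
    have hy : q ^ (-y) * q ^ y = 1 := by rw [← zpow_add₀ hq]; simp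
    have hA := qPoch_succ q (q ^ (-x)) j
    have hA' := qPoch_succ' q (q ^ (-x)) j
    simp only [hF, hG]
    rw [hjn, qPoch_succ' q (q ^ ((j : ℤ) - (x + y))), e2, e1, e3, e4, e5, mul_pow]
    generalize qPoch q (q ^ ((j : ℤ) - (x + y - 1))) (n - j) = B
    generalize qPoch q (q ^ (-x) * q) j = A₁ at *
    rw [hA'] at hA ⊢
    generalize qPoch q (q ^ (-x)) j = A₀ at *
    generalize q ^ (-x) = a at *
    generalize q ^ (-y) = c at *
    generalize q ^ x = a' at *
    generalize q ^ y = c' at *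
    generalize (q ^ (n + 1)) ^ j = Q
    generalize q ^ j = r at *
    rw [pow_succ]
    generalize qPoch q (q ^ (-(n : ℤ))) j = C
    rw [div_eq_mul_inv, div_eq_mul_inv, div_eq_mul_inv]
    generalize (qPoch q q j)⁻¹ = D
    generalize p ^ j = P
    linear_combination (C * D * Q * P * B) * (c * hA + A₁ * (c - p * c * c') * hx -
      (p * A₁ * (1 - a)) * hy)
  rw [Finset.sum_congr rfl hR, Finset.sum_sub_distrib, ← Finset.mul_sum, ← Finset.mul_sum]
  ring

/-- Raising relation in the first degree index `n₁`. -/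
theorem raising_n1 (q : ℝ) (hq0 : 0 < q) (hq1 : q < 1)
    (N : ℕ) (hN : 1 ≤ N) (θ φ : ℝ) (hθ : θ ≠ 0) (hφ : φ ≠ 0)
    (n₁ n₂ : ℕ) (hn : n₁ + n₂ ≤ N - 1) (x₁ x₂ : ℕ) (hx : x₁ + x₂ ≤ N) :
    q ^ (-(n₁ : ℤ)) * Kq q (n₁ + 1) n₂ x₁ x₂ (Real.sqrt q * θ) φ N
    = q ^ (-((x₁ : ℤ) + x₂)) * (1 - q ^ x₁) * (1 - (θ ^ 2)⁻¹ * q ^ x₂) *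
        Kq q n₁ n₂ ((x₁ : ℤ) - 1) x₂ θ φ ((N : ℤ) - 1)
      - (1 - q ^ (-(x₂ : ℤ))) * Kq q n₁ n₂ x₁ ((x₂ : ℤ) - 1) θ φ ((N : ℤ) - 1) := by
  have hsq : ((Real.sqrt q * θ) ^ 2)⁻¹ = q⁻¹ * (θ ^ 2)⁻¹ := by
    rw [mul_pow, Real.sq_sqrt hq0.le, mul_inv]
  have h := qKraw_raising hq0 hq1 n₁ x₁ x₂ (θ ^ 2)⁻¹
  have c₁ : (0 : ℤ) ≤ (n₁ : ℤ) + 1 ∧ (0 : ℤ) ≤ n₂ := by omega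
  have c₂ : (0 : ℤ) ≤ (n₁ : ℤ) ∧ (0 : ℤ) ≤ n₂ := by omega
  have t₁ : ((n₁ : ℤ) + 1).toNat = n₁ + 1 := by omega
  have i₁ : (x₁ : ℤ) - 1 + x₂ = x₁ + x₂ - 1 := by ring
  have i₂ : (x₁ : ℤ) + (x₂ - 1) = x₁ + x₂ - 1 := by ring
  have i₃ : (x₁ : ℤ) + x₂ - (n₁ + 1) = x₁ + x₂ - 1 - n₁ := by ring
  have i₄ : (N : ℤ) - (n₁ + 1) = N - 1 - n₁ := by ring
  simp only [Kq, if_pos c₁, if_pos c₂, t₁, Int.toNat_natCast, hsq, i₁, i₂, i₃, i₄]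
  simp only [zpow_natCast] at h
  linear_combination qKraw q n₂ ((x₁ : ℤ) + x₂ - 1 - n₁) (N - 1 - n₁) (φ ^ 2)⁻¹ * h
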